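/- Let M₂(z) = (1 + 2z − √(1−4z))/(4z) for z ≠ 0 (and M₂(0) = 1). Then there exists ε > 0 such that for all real z with 0 < |z| < ε, M₂(2z/(1+2z)²) = 1 + z. -/

import Mathlib

/-- The moment generating function of the measure `μ₂`. -/
noncomputable def M₂ (z : ℝ) : ℝ :=
  if z = 0 then 1 else (1 + 2 * z - Real.sqrt (1 - 4 * z)) / (4 * z)

theorem stmt_19 :
    ∃ ε > (0 : ℝ), ∀ z : ℝ, 0 < |z| → |z| < ε →
      M₂ (2 * z / (1 + 2 * z) ^ 2) = 1 + z := by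
  refine ⟨1 / 4, by norm_num, fun z hz0 hz => ?_⟩
  have hz0' : z ≠ 0 := abs_pos.mp hz0
  obtain ⟨h1, h2⟩ := abs_lt.mp hz
  have hp : 0 < 1 + 2 * z := by linarith
  have hm : 0 ≤ 1 - 2 * z := by linarith
  have hne : 1 + 2 * z ≠ 0 := hp.ne'
  have hw : 2 * z / (1 + 2 * z) ^ 2 ≠ 0 := by positivity
  have hs : Real.sqrt (1 - 4 * (2 * z / (1 + 2 * z) ^ 2)) = (1 - 2 * z) / (1 + 2 * z) := by
    have : 1 - 4 * (2 * z / (1 + 2 * z) ^ 2) = ((1 - 2 * z) / (1 + 2 * z)) ^ 2 := by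
      field_simp
      ring
    rw [this, Real.sqrt_sq (by positivity)]
  rw [M₂, if_neg hw, hs]
  field_simp
  ring
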